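/- arXiv:1610.00167 — 6 statements merged into one kernel-verified Lean document; each statement's English description precedes it below -/
import Mathlib

section
/- Let g ≥ 2 be an integer, N = 8g−4, G a group, and T : ZMod N → G a family of elements satisfying T_{σ(i)} · T_i = 1 for all i and T_{ρ³(i)} · T_{ρ²(i)} · T_{ρ(i)} · T_i = 1 for all i. Then for every i, T_{ρ(i)} · T_i = T_{θ(i−1)} · T_{i−1}. -/
/-- The side-pairing map `σ` on `ZMod (8g-4)`:
`σ(i) ≡ 4g - i` if `i` is odd, `σ(i) ≡ 2 - i` if `i` is even. -/
def pairingSigma (g : ℕ) (i : ZMod (8*g-4)) : ZMod (8*g-4) :=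
  if i.val % 2 = 1 then ((4*g : ℕ) : ZMod (8*g-4)) - i else (2 : ZMod (8*g-4)) - i

/-- `ρ(i) = σ(i) + 1`. -/
def pairingRho (g : ℕ) (i : ZMod (8*g-4)) : ZMod (8*g-4) := pairingSigma g i + 1

/-- `θ(i) = σ(i) - 1`. -/
def pairingTheta (g : ℕ) (i : ZMod (8*g-4)) : ZMod (8*g-4) := pairingSigma g i - 1

theorem two_dvd_eight_mul_sub_four (g : ℕ) : 2 ∣ 8 * g - 4 := by omega

/-- Reduction modulo `2` on `ZMod (8g-4)`. -/
def parityHom (g : ℕ) : ZMod (8*g-4) →+* ZMod 2 :=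
  ZMod.castHom (two_dvd_eight_mul_sub_four g) (ZMod 2)

theorem val_mod_two_eq_one_iff {g : ℕ} (hg : 1 ≤ g) (i : ZMod (8*g-4)) :
    i.val % 2 = 1 ↔ parityHom g i = 1 := by
  have : NeZero (8*g-4) := ⟨by omega⟩
  have h : parityHom g i = ((i.val : ℕ) : ZMod 2) := by
    rw [← map_natCast (parityHom g), ZMod.natCast_zmod_val]
  rw [h, ZMod.natCast_eq_one_iff_odd, Nat.odd_iff]

theorem parityHom_eq_zero_or_one (g : ℕ) (i : ZMod (8*g-4)) :
    parityHom g i = 0 ∨ parityHom g i = 1 := by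
  generalize parityHom g i = x
  revert x
  decide

theorem pairingSigma_of_odd {g : ℕ} (hg : 1 ≤ g) {i : ZMod (8*g-4)} (hi : parityHom g i = 1) :
    pairingSigma g i = 4 * g - i := by
  simp [pairingSigma, (val_mod_two_eq_one_iff hg i).2 hi]

theorem pairingSigma_of_even {g : ℕ} (hg : 1 ≤ g) {i : ZMod (8*g-4)} (hi : parityHom g i = 0) :
    pairingSigma g i = 2 - i := by
  rw [pairingSigma, if_neg]
  simp [val_mod_two_eq_one_iff hg, hi]

theorem eight_mul_natCast_eq_four {g : ℕ} (hg : 1 ≤ g) : (8 * g : ZMod (8*g-4)) = 4 := by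
  have h : ((8 * g - 4 : ℕ) : ZMod (8*g-4)) = 0 := ZMod.natCast_self _
  rw [Nat.cast_sub (by omega)] at h
  push_cast at h
  exact sub_eq_zero.1 h

theorem parityHom_two (g : ℕ) : parityHom g 2 = 0 := by
  rw [map_ofNat]
  rfl

theorem parityHom_four_mul (g : ℕ) (x : ZMod (8*g-4)) : parityHom g (4 * x) = 0 := by
  rw [show (4 : ZMod (8*g-4)) * x = 2 * (2 * x) by ring, map_mul, parityHom_two, zero_mul]

theorem parityHom_pairingSigma {g : ℕ} (hg : 1 ≤ g) (i : ZMod (8*g-4)) :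
    parityHom g (pairingSigma g i) = parityHom g i := by
  rcases parityHom_eq_zero_or_one g i with hi | hi
  · rw [pairingSigma_of_even hg hi, map_sub, hi, parityHom_two, sub_zero]
  · rw [pairingSigma_of_odd hg hi, map_sub, hi, parityHom_four_mul]
    rfl

theorem parityHom_pairingRho {g : ℕ} (hg : 1 ≤ g) (i : ZMod (8*g-4)) :
    parityHom g (pairingRho g i) = parityHom g i + 1 := by
  rw [pairingRho, map_add, map_one, parityHom_pairingSigma hg]

theorem pairingRho_iterates {g : ℕ} (hg : 1 ≤ g) (i : ZMod (8*g-4)) :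
    pairingSigma g (pairingRho g (pairingRho g i)) = pairingTheta g (i - 1) ∧
    pairingSigma g (pairingRho g (pairingRho g (pairingRho g i))) = i - 1 := by
  have h8 := eight_mul_natCast_eq_four hg
  have p1 := parityHom_pairingRho hg i
  have p2 := parityHom_pairingRho hg (pairingRho g i)
  have p3 := parityHom_pairingRho hg (pairingRho g (pairingRho g i))
  have pm : parityHom g (i - 1) = parityHom g i - 1 := by rw [map_sub, map_one]
  have h2 : (1 + 1 : ZMod 2) = 0 := rfl
  rcases parityHom_eq_zero_or_one g i with hi | hi
  · rw [hi, zero_add] at p1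
    rw [p1, h2] at p2
    rw [p2, zero_add] at p3
    rw [hi, show (0 - 1 : ZMod 2) = 1 from rfl] at pm
    rw [pairingTheta, pairingSigma_of_odd hg p3, pairingSigma_of_even hg p2,
      pairingSigma_of_odd hg pm]
    simp only [pairingRho] at p1 p2 ⊢
    rw [pairingSigma_of_even hg p2, pairingSigma_of_odd hg p1, pairingSigma_of_even hg hi]
    exact ⟨by linear_combination -h8, by linear_combination h8⟩
  · rw [hi, h2] at p1
    rw [p1, zero_add] at p2
    rw [p2, h2] at p3
    rw [hi, sub_self] at pm
    rw [pairingTheta, pairingSigma_of_even hg p3, pairingSigma_of_odd hg p2,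
      pairingSigma_of_even hg pm]
    simp only [pairingRho] at p1 p2 ⊢
    rw [pairingSigma_of_odd hg p2, pairingSigma_of_even hg p1, pairingSigma_of_odd hg hi]
    exact ⟨by linear_combination h8, by linear_combination -h8⟩

theorem short_cycle_relation (g : ℕ) (hg : 2 ≤ g) (G : Type*) [Group G]
    (T : ZMod (8*g-4) → G)
    (h1 : ∀ i, T (pairingSigma g i) * T i = 1)
    (h2 : ∀ i, T (pairingRho g (pairingRho g (pairingRho g i))) *
      T (pairingRho g (pairingRho g i)) * T (pairingRho g i) * T i = 1) :
    ∀ i, T (pairingRho g i) * T i = T (pairingTheta g (i - 1)) * T (i - 1) := by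
  intro i
  obtain ⟨hθ, hσ⟩ := pairingRho_iterates (by omega : 1 ≤ g) i
  have e2 := h1 (pairingRho g (pairingRho g i))
  have e3 := h1 (pairingRho g (pairingRho g (pairingRho g i)))
  rw [hθ] at e2
  rw [hσ] at e3
  have e := h2 i
  rw [mul_assoc, mul_eq_one_iff_inv_eq] at e
  rw [eq_inv_of_mul_eq_one_left e2, eq_inv_of_mul_eq_one_left e3, ← e, mul_inv_rev]
end

section
/- Let g ≥ 2 be an integer and i an integer with i ≡ 1 (mod 4). If g is even, then there exists a natural number n such that i + n(4g−4) ≡ 2g+1 (mod 8g−4); if g is odd, then there exists a natural number n such that i + n(4g−4) ≡ 6g−1 (mod 8g−4). -/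
/-- For `g ≥ 1`, the progression `i + n(4g-4)` meets every class modulo `8g-4` that agrees with `i`
modulo `4`. -/
theorem exists_nat_add_mul_modEq (g i t : ℤ) (hg : 1 ≤ g) (h : i ≡ t [ZMOD 4]) :
    ∃ n : ℕ, i + (n : ℤ) * (4*g - 4) ≡ t [ZMOD 8*g - 4] := by
  obtain ⟨k, hk⟩ := h.dvd
  have hn : 0 ≤ (-2 * k) % (2*g - 1) := Int.emod_nonneg _ (by omega)
  refine ⟨((-2 * k) % (2*g - 1)).toNat, ?_⟩
  rw [Int.toNat_of_nonneg hn, Int.modEq_iff_dvd]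
  refine ⟨k + (-2 * k) / (2*g - 1) * (g - 1), ?_⟩
  linear_combination hk - (4*g - 4) * Int.emod_add_mul_ediv (-2 * k) (2*g - 1)

theorem hits_class_one_mod_four (g i : ℤ) (hg : 2 ≤ g) (hi : i ≡ 1 [ZMOD 4]) :
    (Even g → ∃ n : ℕ, i + (n : ℤ) * (4*g - 4) ≡ 2*g + 1 [ZMOD 8*g - 4]) ∧
    (Odd g → ∃ n : ℕ, i + (n : ℤ) * (4*g - 4) ≡ 6*g - 1 [ZMOD 8*g - 4]) := by
  constructor <;> rintro ⟨m, hm⟩ <;> apply exists_nat_add_mul_modEq _ _ _ (by omega) <;>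
    · unfold Int.ModEq at *
      omega
end

section
/- Let a, b, c, d be real numbers with a ≤ b and c ≤ d, and suppose that sin((θ−φ)/2) ≠ 0 for all θ ∈ [a,b] and φ ∈ [c,d]. Then ∫_c^d ∫_a^b dθ dφ/(2 − 2cos(θ−φ)) = ln( |sin((d−b)/2)| · |sin((c−a)/2)| / ( |sin((c−b)/2)| · |sin((d−a)/2)| ) ). -/
open Real

theorem two_sub_two_cos_eq (x : ℝ) : 2 - 2 * Real.cos x = 4 * Real.sin (x / 2) ^ 2 := by
  rw [Real.sin_sq_eq_half_sub, mul_div_cancel₀ x two_ne_zero]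
  ring

theorem hasDerivAt_neg_half_cot_half_sub {θ φ : ℝ} (h : Real.sin ((θ - φ) / 2) ≠ 0) :
    HasDerivAt (fun t => -(Real.cos ((t - φ) / 2) / Real.sin ((t - φ) / 2)) / 2)
      (1 / (2 - 2 * Real.cos (θ - φ))) θ := by
  have hlin : HasDerivAt (fun t => (t - φ) / 2) (1 / 2) θ :=
    ((hasDerivAt_id θ).sub_const φ).div_const 2
  refine ((hlin.cos.div hlin.sin h).neg.div_const 2).congr_deriv ?_
  rw [two_sub_two_cos_eq]
  field_simp
  linear_combination 4 * Real.sin_sq_add_cos_sq ((θ - φ) / 2)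

theorem hasDerivAt_log_sin_half_sub {θ φ : ℝ} (h : Real.sin ((θ - φ) / 2) ≠ 0) :
    HasDerivAt (fun t => Real.log (Real.sin ((θ - t) / 2)))
      (-(Real.cos ((θ - φ) / 2) / Real.sin ((θ - φ) / 2)) / 2) φ := by
  have hlin : HasDerivAt (fun t => (θ - t) / 2) (-1 / 2) φ :=
    ((hasDerivAt_id φ).const_sub θ).div_const 2
  refine (hlin.sin.log h).congr_deriv ?_
  ring

theorem integral_inv_two_sub_two_cos {a b φ : ℝ} (hab : a ≤ b)
    (h : ∀ θ ∈ Set.Icc a b, Real.sin ((θ - φ) / 2) ≠ 0) :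
    ∫ θ in a..b, 1 / (2 - 2 * Real.cos (θ - φ))
      = -(Real.cos ((b - φ) / 2) / Real.sin ((b - φ) / 2)) / 2
        - -(Real.cos ((a - φ) / 2) / Real.sin ((a - φ) / 2)) / 2 := by
  rw [← Set.uIcc_of_le hab] at h
  refine intervalIntegral.integral_eq_sub_of_hasDerivAt
    (fun θ hθ => hasDerivAt_neg_half_cot_half_sub (h θ hθ)) ?_
  refine (ContinuousOn.div (by fun_prop) (by fun_prop) fun θ hθ => ?_).intervalIntegrable
  rw [two_sub_two_cos_eq]
  exact mul_ne_zero four_ne_zero (pow_ne_zero 2 (h θ hθ))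

theorem intervalIntegrable_neg_half_cot_half_sub {θ c d : ℝ} (hcd : c ≤ d)
    (h : ∀ φ ∈ Set.Icc c d, Real.sin ((θ - φ) / 2) ≠ 0) :
    IntervalIntegrable (fun φ => -(Real.cos ((θ - φ) / 2) / Real.sin ((θ - φ) / 2)) / 2)
      MeasureTheory.volume c d := by
  rw [← Set.uIcc_of_le hcd] at h
  exact ((ContinuousOn.div (by fun_prop) (by fun_prop) h).neg.div_const 2).intervalIntegrable

theorem integral_neg_half_cot_half_sub {θ c d : ℝ} (hcd : c ≤ d)
    (h : ∀ φ ∈ Set.Icc c d, Real.sin ((θ - φ) / 2) ≠ 0) :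
    ∫ φ in c..d, -(Real.cos ((θ - φ) / 2) / Real.sin ((θ - φ) / 2)) / 2
      = Real.log (Real.sin ((θ - d) / 2)) - Real.log (Real.sin ((θ - c) / 2)) :=
  intervalIntegral.integral_eq_sub_of_hasDerivAt
    (fun φ hφ => hasDerivAt_log_sin_half_sub (h φ (Set.uIcc_of_le hcd ▸ hφ)))
    (intervalIntegrable_neg_half_cot_half_sub hcd h)

theorem abs_sin_half_sub_comm (x y : ℝ) :
    |Real.sin ((x - y) / 2)| = |Real.sin ((y - x) / 2)| := by
  rw [← neg_sub y x, neg_div, Real.sin_neg, abs_neg]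

theorem double_integral_inv_two_sub_two_cos (a b c d : ℝ) (hab : a ≤ b) (hcd : c ≤ d)
    (h : ∀ θ ∈ Set.Icc a b, ∀ φ ∈ Set.Icc c d, Real.sin ((θ - φ)/2) ≠ 0) :
    ∫ φ in c..d, ∫ θ in a..b, 1/(2 - 2*Real.cos (θ - φ))
      = Real.log (|Real.sin ((d - b)/2)| * |Real.sin ((c - a)/2)| /
          (|Real.sin ((c - b)/2)| * |Real.sin ((d - a)/2)|)) := by
  have ha := h a (Set.left_mem_Icc.2 hab)
  have hb := h b (Set.right_mem_Icc.2 hab)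
  have hc := Set.left_mem_Icc.2 hcd
  have hd := Set.right_mem_Icc.2 hcd
  rw [intervalIntegral.integral_congr fun φ hφ => integral_inv_two_sub_two_cos hab
      fun θ hθ => h θ hθ φ (Set.uIcc_of_le hcd ▸ hφ),
    intervalIntegral.integral_sub (intervalIntegrable_neg_half_cot_half_sub hcd hb)
      (intervalIntegrable_neg_half_cot_half_sub hcd ha),
    integral_neg_half_cot_half_sub hcd hb, integral_neg_half_cot_half_sub hcd ha,
    abs_sin_half_sub_comm d b, abs_sin_half_sub_comm c a, abs_sin_half_sub_comm c b,
    abs_sin_half_sub_comm d a]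
  have hac := abs_ne_zero.2 (ha c hc)
  have had := abs_ne_zero.2 (ha d hd)
  have hbc := abs_ne_zero.2 (hb c hc)
  have hbd := abs_ne_zero.2 (hb d hd)
  rw [Real.log_div (mul_ne_zero hbd hac) (mul_ne_zero hbc had), Real.log_mul hbd hac,
    Real.log_mul hbc had]
  simp only [Real.log_abs]
  ring
end

section
/- For every real number t with 0 < t ≤ π/12, one has 3t − 2·arcsin(√2 · sin t) > 0. -/
open Real

theorem h_pos (t : ℝ) (ht : 0 < t) (ht' : t ≤ π/12) :
    3*t - 2*Real.arcsin (Real.sqrt 2 * Real.sin t) > 0 := by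
  have hπ : π < 3.15 := pi_lt_d2
  obtain ⟨s, rfl⟩ : ∃ s, t = 2 * s := ⟨t / 2, by ring⟩
  have hs : 0 < s := by linarith
  have hsin : 0 < sin s := sin_pos_of_pos_of_lt_pi hs (by linarith [pi_pos])
  have hcos : 0.99 ≤ cos s := by
    have := one_sub_sq_div_two_le_cos (x := s)
    nlinarith
  have hsqrt : √2 < 1.415 := by
    rw [sqrt_lt' (by norm_num)]
    norm_num
  have hquad : √2 * (2 * cos s) < 4 * cos s ^ 2 - 1 := by nlinarith
  have hlt : √2 * sin (2 * s) < sin (3 * s) := by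
    rw [sin_two_mul, sin_three_mul]
    have hcube : sin s ^ 3 = sin s * (1 - cos s ^ 2) := by rw [← sin_sq]; ring
    linarith [mul_lt_mul_of_pos_left hquad hsin]
  have harcsin : arcsin (√2 * sin (2 * s)) < 3 * s :=
    (arcsin_lt_iff_lt_sin' ⟨by linarith [pi_pos], by linarith [pi_pos]⟩).2 hlt
  linarith
end

section
/- For every real number t with 0 < t ≤ π/12, setting φ = arcsin(√2·sin t), one has √(cos 2t)/cos t − cos(3t − φ) > 0. -/
open Real

theorem g_pos (t : ℝ) (ht : 0 < t) (ht' : t ≤ π/12) :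
    Real.sqrt (Real.cos (2*t)) / Real.cos t
      - Real.cos (3*t - Real.arcsin (Real.sqrt 2 * Real.sin t)) > 0 := by
  have hs : 0 < sin t := sin_pos_of_pos_of_lt_pi ht (by linarith [pi_pos])
  have hc : 0 < cos t := cos_pos_of_mem_Ioo ⟨by linarith [pi_pos], by linarith [pi_pos]⟩
  have hs' : sin t ≤ 1 / 2 := by
    rw [← sin_pi_div_six]
    exact sin_le_sin_of_le_of_le_pi_div_two (by linarith [pi_pos]) (by linarith [pi_pos])
      (by linarith [pi_pos])
  have hx : sin t ^ 2 ≤ 1 / 4 := by nlinarith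
  have hcs : cos t ^ 2 = 1 - sin t ^ 2 := by linarith [sin_sq_add_cos_sq t]
  have h2 : √2 ^ 2 = 2 := sq_sqrt (by norm_num)
  have h2pos : 0 < √2 := by positivity
  have hS : (√2 * sin t) ^ 2 = 2 * sin t ^ 2 := by rw [mul_pow, h2]
  have hS1 : √2 * sin t ≤ 1 := by nlinarith
  have hS0 : 0 < √2 * sin t := by positivity
  have hcos2 : cos (2 * t) = 1 - 2 * sin t ^ 2 := by rw [cos_two_mul, hcs]; ring
  rw [cos_sub, cos_arcsin, sin_arcsin (by linarith) hS1, hS, ← hcos2]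
  set C := √(cos (2 * t)) with hC
  have hCsq : C ^ 2 = 1 - 2 * sin t ^ 2 := by
    rw [hC, sq_sqrt (by rw [hcos2]; linarith), hcos2]
  have hC0 : 0 ≤ C := sqrt_nonneg _
  have key : √2 * cos t * (3 - 4 * sin t ^ 2) < C * (5 - 4 * sin t ^ 2) := by
    refine lt_of_pow_lt_pow_left₀ 2 (mul_nonneg hC0 (by linarith)) ?_
    simp only [mul_pow, h2, hCsq, hcs]
    nlinarith [sq_nonneg (sin t ^ 2)]
  have hid : C / cos t - (cos (3 * t) * C + sin (3 * t) * (√2 * sin t))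
      = sin t ^ 2 * (C * (5 - 4 * sin t ^ 2) - √2 * cos t * (3 - 4 * sin t ^ 2)) / cos t := by
    rw [cos_three_mul, sin_three_mul]
    field_simp
    have hc4 : cos t ^ 4 = (1 - sin t ^ 2) ^ 2 := by rw [← hcs]; ring
    ring_nf
    rw [hc4, hcs]
    ring
  rw [hid]
  exact div_pos (mul_pos (by positivity) (sub_pos.2 key)) hc
end

section
/- For every real number t with 0 < t ≤ π/12, define φ = arcsin(√2·sin t), v = √((cos t − sin t)/(cos t + sin t)), y = √(1 + v² − 2v·cos(3t−φ)), and α = arcsin(v·sin(3t−φ)/y). Then 3t − φ + 2α > π/2. -/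
open Real

theorem one_sub_le_sqrt_cos_sub_sin_div {t : ℝ} (ht : 0 < t) (ht' : t ≤ 0.27) :
    1 - t ≤ √((cos t - sin t) / (cos t + sin t)) := by
  have hs : sin t ≤ t := sin_le ht.le
  have hs0 : 0 < sin t := sin_pos_of_pos_of_lt_pi ht (by linarith [pi_gt_three])
  have hc : 1 - t ^ 2 / 2 ≤ cos t := one_sub_sq_div_two_le_cos
  have hc0 : 0 < cos t := by nlinarith
  apply le_sqrt_of_sq_le
  rw [le_div_iff₀ (by linarith)]
  have h₁ : sin t * (1 + (1 - t) ^ 2) ≤ t * (1 + (1 - t) ^ 2) := by gcongr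
  have h₂ : (1 - t ^ 2 / 2) * (t * (2 - t)) ≤ cos t * (t * (2 - t)) := by
    have : 0 ≤ t * (2 - t) := mul_nonneg ht.le (by linarith)
    gcongr
  have h₃ : 0 ≤ t ^ 2 * (1 - 2 * t + t ^ 2 / 2) := mul_nonneg (sq_nonneg t) (by nlinarith)
  nlinarith

theorem sqrt_two_mul_sin_le_sin {t : ℝ} (ht : 0 < t) (ht' : t ≤ 0.27) :
    √2 * sin t ≤ sin (3 / 2 * t) ∧ 1.4 * t ≤ sin (3 / 2 * t) := by
  have hs : sin t ≤ t := sin_le ht.le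
  have h2 : √2 ≤ 1.4143 := by
    rw [sqrt_le_left (by norm_num)]
    norm_num
  have h := sin_gt_sub_cube (x := 3 / 2 * t) (by linarith)
  have ht2 : t ^ 2 ≤ 0.0729 := by nlinarith
  have h₁ : √2 * sin t ≤ 1.4143 * t := by
    have := sin_nonneg_of_nonneg_of_le_pi ht.le (by linarith [pi_gt_three])
    gcongr
  have h₂ : t * t ^ 2 ≤ t * 0.0729 := by gcongr
  constructor <;> nlinarith

theorem pi_div_two_lt_add_two_mul_arcsin {β v : ℝ} (hβ : 0 < β) (hβ' : β ≤ π / 2)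
    (h : (1 - sin β) * (1 + v ^ 2 - 2 * v * cos β) < 2 * (v * sin β) ^ 2) (hv : 0 < v) :
    π / 2 < β + 2 * arcsin (v * sin β / √(1 + v ^ 2 - 2 * v * cos β)) := by
  have hs : 0 < sin β := sin_pos_of_pos_of_lt_pi hβ (by linarith [pi_pos])
  have hY : 0 < 1 + v ^ 2 - 2 * v * cos β := by
    nlinarith [sin_sq_add_cos_sq β, sq_nonneg (v - cos β), pow_pos hs 2]
  have hsin : sin (π / 4 - β / 2) ^ 2 = (1 - sin β) / 2 := by
    rw [sin_sq_eq_half_sub, show 2 * (π / 4 - β / 2) = π / 2 - β by ring, cos_pi_div_two_sub]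
    ring
  have key : π / 4 - β / 2 < arcsin (v * sin β / √(1 + v ^ 2 - 2 * v * cos β)) := by
    rw [lt_arcsin_iff_sin_lt' ⟨by linarith [pi_pos], by linarith [pi_pos]⟩,
      lt_div_iff₀ (sqrt_pos.2 hY)]
    refine lt_of_pow_lt_pow_left₀ 2 (by positivity) ?_
    rw [mul_pow, sq_sqrt hY.le, hsin]
    linarith
  linarith

theorem omega_gt_pi_div_four (t : ℝ) (ht : 0 < t) (ht' : t ≤ π/12)
    (φ v y α : ℝ)
    (hφ : φ = Real.arcsin (Real.sqrt 2 * Real.sin t))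
    (hv : v = Real.sqrt ((Real.cos t - Real.sin t)/(Real.cos t + Real.sin t)))
    (hy : y = Real.sqrt (1 + v^2 - 2*v*Real.cos (3*t - φ)))
    (hα : α = Real.arcsin (v * Real.sin (3*t - φ) / y)) :
    3*t - φ + 2*α > π/2 := by
  have hπ := pi_pos
  have ht3 : t ≤ 0.27 := by linarith [pi_lt_d2]
  have hs0 : 0 < sin t := sin_pos_of_pos_of_lt_pi ht (by linarith)
  have hc0 : 0 < cos t := cos_pos_of_mem_Ioo ⟨by linarith, by linarith⟩
  have hv1 : 1 - t ≤ v := hv ▸ one_sub_le_sqrt_cos_sub_sin_div ht ht3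
  have hv2 : v ≤ 1 := by
    rw [hv, sqrt_le_one, div_le_one (by linarith)]
    linarith
  obtain ⟨hsin, hsin'⟩ := sqrt_two_mul_sin_le_sin ht ht3
  have hφ0 : 0 ≤ φ := hφ ▸ arcsin_nonneg.2 (by positivity)
  have hφ1 : φ ≤ 3 / 2 * t := by
    rw [hφ]
    exact (arcsin_le_iff_le_sin' ⟨by linarith, by linarith⟩).2 hsin
  rw [hα, hy]
  generalize hβ : 3 * t - φ = β
  have hsβ : 1.4 * t ≤ sin β :=
    hsin'.trans (sin_le_sin_of_le_of_le_pi_div_two (by linarith) (by linarith) (by linarith))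
  have hcβ : 0.7 ≤ cos β := by
    have h := cos_le_cos_of_nonneg_of_le_pi (x := β) (y := π / 4) (by linarith) (by linarith)
      (by linarith)
    rw [cos_pi_div_four] at h
    have : 1.4 ≤ √2 := le_sqrt_of_sq_le (by norm_num)
    linarith
  refine pi_div_two_lt_add_two_mul_arcsin (by linarith) (by linarith) ?_ (by linarith)
  have hs1 := sin_le_one β
  have hsc := sin_sq_add_cos_sq β
  generalize sin β = s at *
  generalize cos β = c at *
  have hs : 0 < s := by linarith
  have hvt : (1 - v) ^ 2 ≤ 0.52 * s ^ 2 := by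
    have : (1.4 * (1 - v)) ^ 2 ≤ s ^ 2 := by
      apply pow_le_pow_left₀ <;> linarith
    nlinarith
  have hc : 2 * (1 - c) ≤ 1.18 * s ^ 2 := by nlinarith
  have hY : 1 + v ^ 2 - 2 * v * c ≤ (0.52 + 1.18 * v) * s ^ 2 := by nlinarith
  have hfac : (1 - s) * (0.52 + 1.18 * v) < 2 * v ^ 2 := by nlinarith
  calc (1 - s) * (1 + v ^ 2 - 2 * v * c) ≤ (1 - s) * ((0.52 + 1.18 * v) * s ^ 2) := by
        have : 0 ≤ 1 - s := by linarith
        gcongr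
    _ = (1 - s) * (0.52 + 1.18 * v) * s ^ 2 := by ring
    _ < 2 * v ^ 2 * s ^ 2 := by gcongr
    _ = 2 * (v * s) ^ 2 := by ring
end
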